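/- Suppose condition (⋆) holds and g is a simple graph on {1,…,n} with η_i(g) = k_i for every firm i. Then for every pair of distinct vertices ij that is not an edge of g, Y_i(g + ij) ≤ Y_i(g); that is, no firm can increase its profit by adding a new collaboration link. -/

import Mathlib

open Finset

noncomputable def degree' {n : ℕ} (g : SimpleGraph (Fin n)) (i : Fin n) : ℕ :=
  Nat.card {j | g.Adj i j}

/-- The graph `g` with the edge `ij` deleted. -/
def delE {n : ℕ} (g : SimpleGraph (Fin n)) (i j : Fin n) : SimpleGraph (Fin n) :=
  g.deleteEdges {s(i, j)}

/-- The graph `g` with the edge `ij` added. -/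
def addE {n : ℕ} (g : SimpleGraph (Fin n)) (i j : Fin n) : SimpleGraph (Fin n) :=
  g ⊔ SimpleGraph.fromEdgeSet {s(i, j)}

/-- Cournot equilibrium quantity of firm `i` under collaboration graph `g`. -/
noncomputable def qty {n : ℕ} (α γ₀ : ℝ) (f : ℝ → ℝ) (k : Fin n → ℕ)
    (g : SimpleGraph (Fin n)) (i : Fin n) : ℝ :=
  (α - γ₀ - n * f ((degree' g i : ℝ) - (k i : ℝ))
    + ∑ j ∈ univ.erase i, f ((degree' g j : ℝ) - (k j : ℝ))) / (n + 1)

/-- Market price under collaboration graph `g`. -/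
noncomputable def price {n : ℕ} (α γ₀ : ℝ) (f : ℝ → ℝ) (k : Fin n → ℕ)
    (g : SimpleGraph (Fin n)) : ℝ :=
  α - ∑ i, qty α γ₀ f k g i

/-- Marginal cost of firm `i` under collaboration graph `g`. -/
noncomputable def cost {n : ℕ} (γ₀ : ℝ) (f : ℝ → ℝ) (k : Fin n → ℕ)
    (g : SimpleGraph (Fin n)) (i : Fin n) : ℝ :=
  γ₀ + f ((degree' g i : ℝ) - (k i : ℝ))

/-- Profit of firm `i` under collaboration graph `g`. -/
noncomputable def profit {n : ℕ} (α γ₀ : ℝ) (f : ℝ → ℝ) (k : Fin n → ℕ)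
    (g : SimpleGraph (Fin n)) (i : Fin n) : ℝ :=
  qty α γ₀ f k g i * (price α γ₀ f k g - cost γ₀ f k g i)

/-- In Cournot equilibrium the mark-up of firm `i` equals its quantity. -/
lemma price_sub_cost {n : ℕ} (α γ₀ : ℝ) (f : ℝ → ℝ) (k : Fin n → ℕ)
    (g : SimpleGraph (Fin n)) (i : Fin n) :
    price α γ₀ f k g - cost γ₀ f k g i = qty α γ₀ f k g i := by
  have hn : (n : ℝ) + 1 ≠ 0 := by positivity
  unfold price cost qty
  simp only [sum_erase_eq_sub (mem_univ _), ← sum_div, sum_add_distrib, sum_sub_distrib,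
    ← mul_sum, sum_const, card_univ, Fintype.card_fin, nsmul_eq_mul]
  field_simp
  ring

lemma profit_eq_qty_sq {n : ℕ} (α γ₀ : ℝ) (f : ℝ → ℝ) (k : Fin n → ℕ)
    (g : SimpleGraph (Fin n)) (i : Fin n) :
    profit α γ₀ f k g i = qty α γ₀ f k g i ^ 2 := by
  rw [profit, price_sub_cost, sq]

lemma addE_comm {n : ℕ} (g : SimpleGraph (Fin n)) (i j : Fin n) :
    addE g i j = addE g j i := by
  rw [addE, addE, Sym2.eq_swap]

lemma degree'_addE_left {n : ℕ} {g : SimpleGraph (Fin n)} {i j : Fin n} (hne : i ≠ j)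
    (hij : ¬ g.Adj i j) : degree' (addE g i j) i = degree' g i + 1 := by
  have h : {l | (addE g i j).Adj i l} = insert j {l | g.Adj i l} := by
    ext l
    simp only [addE, SimpleGraph.sup_adj, SimpleGraph.fromEdgeSet_adj, Set.mem_ofPred_eq,
      Set.mem_singleton_iff, Set.mem_insert_iff, Sym2.eq_iff]
    grind
  rw [degree', degree', h, Nat.card_coe_set_eq, Nat.card_coe_set_eq,
    Set.ncard_insert_of_notMem (s := {l | g.Adj i l}) hij]

lemma degree'_addE_of_ne {n : ℕ} (g : SimpleGraph (Fin n)) {i j l : Fin n} (hi : l ≠ i)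
    (hj : l ≠ j) : degree' (addE g i j) l = degree' g l := by
  have h : {m | (addE g i j).Adj l m} = {m | g.Adj l m} := by
    ext m
    simp only [addE, SimpleGraph.sup_adj, SimpleGraph.fromEdgeSet_adj, Set.mem_ofPred_eq,
      Set.mem_singleton_iff, Sym2.eq_iff]
    grind
  rw [degree', degree', h]

lemma qty_of_degree'_eq {n : ℕ} (α γ₀ : ℝ) (f : ℝ → ℝ) {k : Fin n → ℕ}
    {g : SimpleGraph (Fin n)} (hdeg : ∀ i, degree' g i = k i) (i : Fin n) :
    qty α γ₀ f k g i = (α - γ₀ - f 0) / (n + 1) := by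
  simp only [qty, hdeg, sub_self, sum_erase_eq_sub (mem_univ _), sum_const, card_univ,
    Fintype.card_fin, nsmul_eq_mul]
  ring

lemma qty_addE_of_degree'_eq {n : ℕ} (α γ₀ : ℝ) (f : ℝ → ℝ) {k : Fin n → ℕ}
    {g : SimpleGraph (Fin n)} (hdeg : ∀ i, degree' g i = k i) {i j : Fin n} (hne : i ≠ j)
    (hij : ¬ g.Adj i j) :
    qty α γ₀ f k (addE g i j) i
      = (α - γ₀ - f 0 - (n - 1) * (f 1 - f 0)) / (n + 1) := by
  have hi : degree' (addE g i j) i = k i + 1 := by rw [degree'_addE_left hne hij, hdeg]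
  have hj : degree' (addE g i j) j = k j + 1 := by
    rw [addE_comm, degree'_addE_left hne.symm (fun h => hij h.symm), hdeg]
  have hsum : ∑ l ∈ univ.erase i, f ((degree' (addE g i j) l : ℝ) - (k l : ℝ))
      = ∑ l ∈ univ.erase i, (f 0 + if l = j then f 1 - f 0 else 0) := by
    refine sum_congr rfl fun l hl => ?_
    by_cases hlj : l = j
    · subst hlj
      simp [hj]
    · simp [degree'_addE_of_ne g (ne_of_mem_erase hl) hlj, hdeg, hlj]
  rw [qty, hsum, sum_add_distrib, sum_ite_eq', if_pos (mem_erase.2 ⟨hne.symm, mem_univ j⟩),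
    sum_erase_eq_sub (mem_univ i), hi]
  simp only [Nat.cast_add, Nat.cast_one, add_sub_cancel_left, sum_const, card_univ,
    Fintype.card_fin, nsmul_eq_mul]
  ring

/-- under condition (⋆), no firm gains by adding a link. -/
theorem stmt8 (n : ℕ) (hn : 2 ≤ n) (α γ₀ : ℝ) (f : ℝ → ℝ)
    (hconv : ConvexOn ℝ Set.univ f) (hf0 : ∀ x, 0 ≤ f x) (hfmin : ∀ x, f 0 ≤ f x)
    (k : Fin n → ℕ) (hk : ∀ i, k i ≤ n - 1)
    (hstar : 0 < α - γ₀ - n * max (f ((n : ℝ) - 1)) (f (1 - (n : ℝ)))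
      - (((n : ℝ) - 1) / 2) * max (f 1 - f 0) (f (-1) - f 0))
    (g : SimpleGraph (Fin n)) (hdeg : ∀ i, degree' g i = k i)
    (i j : Fin n) (hne : i ≠ j) (hij : ¬ g.Adj i j) :
    profit α γ₀ f k (addE g i j) i ≤ profit α γ₀ f k g i := by
  have hn' : (2 : ℝ) ≤ n := by exact_mod_cast hn
  have hf1 := hfmin 1
  have hmax : n * f 0 ≤ n * max (f ((n : ℝ) - 1)) (f (1 - (n : ℝ))) := by
    gcongr
    exact (hfmin _).trans (le_max_left _ _)
  have hgap : ((n : ℝ) - 1) / 2 * (f 1 - f 0)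
      ≤ ((n : ℝ) - 1) / 2 * max (f 1 - f 0) (f (-1) - f 0) :=
    mul_le_mul_of_nonneg_left (le_max_left _ _) (by linarith)
  have hnf : f 0 ≤ n * f 0 := le_mul_of_one_le_left (hf0 0) (by linarith)
  have hpos : 0 ≤ ((n : ℝ) - 1) * (f 1 - f 0) :=
    mul_nonneg (by linarith) (by linarith)
  rw [profit_eq_qty_sq, profit_eq_qty_sq, qty_of_degree'_eq α γ₀ f hdeg,
    qty_addE_of_degree'_eq α γ₀ f hdeg hne hij, div_pow, div_pow]
  gcongr ?_ / _
  refine sq_le_sq' ?_ ?_ <;> linarith
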